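/- For every prime number p with p ≠ 2 and p ≠ 7, the rank of the matrix M, with entries reduced modulo p (i.e., viewed as a matrix over the field ℤ/pℤ), equals 13; that is, the rank of M does not drop in any characteristic other than 2 and 7. -/

import Mathlib

open Matrix

def M : Matrix (Fin 19) (Fin 19) ℤ :=
  !![-2,-1,1,0,0,0,0,0,0,0,0,0,0,0,0,0,0,0,0;
    -1,-2,0,1,-1,0,1,0,0,0,0,0,0,0,0,0,0,0,0;
    1,0,-2,0,0,0,0,1,0,0,0,0,0,0,0,0,0,0,0;
    0,1,0,-2,1,0,-2,0,0,0,0,0,0,0,0,0,0,0,1;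
    0,-1,0,1,-2,0,2,0,0,0,1,0,-1,0,0,0,0,0,0;
    0,0,0,0,0,0,0,0,0,0,0,0,0,0,0,0,0,0,0;
    0,1,0,-2,2,0,-4,0,0,1,-1,0,2,0,0,-1,0,0,2;
    0,0,1,0,0,0,0,-2,0,0,0,0,0,1,0,0,0,0,0;
    0,0,0,0,0,0,0,0,0,0,0,0,0,0,0,0,0,0,0;
    0,0,0,0,0,0,1,0,0,-2,0,0,-1,0,0,2,0,0,-1;
    0,0,0,0,1,0,-1,0,0,0,-2,0,2,0,0,0,0,0,0;
    0,0,0,0,0,0,0,0,0,0,0,0,0,0,0,0,0,0,0;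
    0,0,0,0,-1,0,2,0,0,-1,2,0,-4,0,0,2,0,0,-1;
    0,0,0,0,0,0,0,1,0,0,0,0,0,-2,0,0,0,0,0;
    0,0,0,0,0,0,0,0,0,0,0,0,0,0,0,0,0,0,0;
    0,0,0,0,0,0,-1,0,0,2,0,0,2,0,0,-4,0,0,2;
    0,0,0,0,0,0,0,0,0,0,0,0,0,0,0,0,0,0,0;
    0,0,0,0,0,0,0,0,0,0,0,0,0,0,0,0,0,0,0;
    0,0,0,1,0,0,2,0,0,-1,0,0,-1,0,0,2,0,0,-4]

/-- The inverse, multiplied by 14, of the submatrix of `M` on its nonzero rows and columns,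
extended by zero. -/
def scaledInverse : Matrix (Fin 19) (Fin 19) ℤ :=
  !![-40,36,-30,24,-32,0,-24,-20,0,-12,-16,0,-12,-10,0,-8,0,0,-4;
    36,-45,27,-30,40,0,30,18,0,15,20,0,15,9,0,10,0,0,5;
    -30,27,-33,18,-24,0,-18,-22,0,-9,-12,0,-9,-11,0,-6,0,0,-3;
    24,-30,18,-48,36,0,48,12,0,24,18,0,24,6,0,16,0,0,8;
    -32,40,-24,36,-76,0,-64,-16,0,-32,-38,0,-32,-8,0,-26,0,0,-20;
    0,0,0,0,0,0,0,0,0,0,0,0,0,0,0,0,0,0,0;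
    -24,30,-18,48,-64,0,-76,-12,0,-38,-32,0,-38,-6,0,-30,0,0,-22;
    -20,18,-22,12,-16,0,-12,-24,0,-6,-8,0,-6,-12,0,-4,0,0,-2;
    0,0,0,0,0,0,0,0,0,0,0,0,0,0,0,0,0,0,0;
    -12,15,-9,24,-32,0,-38,-6,0,-33,-16,0,-19,-3,0,-22,0,0,-11;
    -16,20,-12,18,-38,0,-32,-8,0,-16,-40,0,-30,-4,0,-20,0,0,-10;
    0,0,0,0,0,0,0,0,0,0,0,0,0,0,0,0,0,0,0;
    -12,15,-9,24,-32,0,-38,-6,0,-19,-30,0,-33,-3,0,-22,0,0,-11;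
    -10,9,-11,6,-8,0,-6,-12,0,-3,-4,0,-3,-13,0,-2,0,0,-1;
    0,0,0,0,0,0,0,0,0,0,0,0,0,0,0,0,0,0,0;
    -8,10,-6,16,-26,0,-30,-4,0,-22,-20,0,-22,-2,0,-24,0,0,-12;
    0,0,0,0,0,0,0,0,0,0,0,0,0,0,0,0,0,0,0;
    0,0,0,0,0,0,0,0,0,0,0,0,0,0,0,0,0,0,0;
    -4,5,-3,8,-20,0,-22,-2,0,-11,-10,0,-11,-1,0,-12,0,0,-13]

theorem M_mul_scaledInverse :
    M * scaledInverse = (14 : ℤ) • diagonal (fun i => if M i i = 0 then 0 else 1) := by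
  decide +kernel

theorem M_mul_support : M * diagonal (fun i => if M i i = 0 then 0 else 1) = M := by
  decide +kernel

theorem rank_M_mod_p (p : ℕ) (hp : p.Prime) (h2 : p ≠ 2) (h7 : p ≠ 7) :
    (M.map (Int.cast : ℤ → ZMod p)).rank = 13 := by
  have : Fact p.Prime := ⟨hp⟩
  let f := Int.castRingHom (ZMod p)
  let D := diagonal (fun i => f (if M i i = 0 then 0 else 1))
  have h14 : (14 : ZMod p) ≠ 0 := by
    intro h
    have hdvd : p ∣ 2 * 7 := (ZMod.natCast_eq_zero_iff 14 p).mp (mod_cast h)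
    rcases hp.dvd_mul.mp hdvd with h | h
    · exact h2 ((Nat.prime_dvd_prime_iff_eq hp Nat.prime_two).mp h)
    · exact h7 ((Nat.prime_dvd_prime_iff_eq hp (by norm_num)).mp h)
  have hD : D = (diagonal (fun i => if M i i = 0 then 0 else 1)).map f := by
    rw [diagonal_map (map_zero f)]
  have hrank : D.rank = 13 := by
    classical
    rw [rank_diagonal, Fintype.card_congr (Equiv.subtypeEquivRight (q := fun i => M i i ≠ 0) ?_)]
    · decide +kernel
    · intro i
      by_cases hi : M i i = 0 <;> simp [hi]
  change (M.map f).rank = 13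
  apply le_antisymm
  · have h : M.map f * D = M.map f := by
      rw [hD, ← Matrix.map_mul, M_mul_support]
    rw [← h, ← hrank]
    exact rank_mul_le_right _ _
  · have h : M.map f * scaledInverse.map f = (14 : ZMod p) • D := by
      rw [hD, ← Matrix.map_mul, M_mul_scaledInverse]
      ext i j
      rw [map_apply, Matrix.smul_apply, Matrix.smul_apply, map_apply, smul_eq_mul, map_mul, smul_eq_mul]
      simp
    rw [← hrank, ← rank_smul_of_mem_nonZeroDivisors D (mem_nonZeroDivisors_of_ne_zero h14), ← h]
    exact rank_mul_le_left _ _
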